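/- Assume in addition that ∫ Q(z, z̃) dz̃ = 1 for all z and ∫ P_z(x, y) dy = 1 for all z, x, and that 𝒵 := ∫_{ℝ^d} exp(−βV(z, x^⊥)) dz dx^⊥ ∈ (0,∞). With 𝒬_s as above, one has ∫ 𝒬_s(u, w) dw ≤ exp(−βV(u)) for all u, and the measure π(du dv) = 𝒵^{−1} 𝒬_s(u, v) du dv + δ_u(dv) (𝒵^{−1} exp(−βV(u)) − 𝒵^{−1} ∫ 𝒬_s(u, w) dw) du on (ℝ^ℓ × ℝ^{d−ℓ})² is invariant under the swap (u, v) ↦ (v, u). Consequently, the Markov chain generated by the symmetric path algorithm is reversible with respect to ν(du) = 𝒵^{−1} exp(−βV(u)) du. -/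

import Mathlib

open MeasureTheory

/-- The path `(ξ_0, ξ_1, …, ξ_{K-1}, ξ_K)` with fixed endpoints `ξ_0 = a`,
`ξ_K = b` and interior points `ξ_k = η_{k-1}` for `1 ≤ k ≤ K − 1`. -/
def pathFun {X : Type*} (K : ℕ) (a b : X) (η : Fin (K - 1) → X) : ℕ → X :=
  fun k => if h : 1 ≤ k ∧ k < K then η ⟨k - 1, by omega⟩ else if k = 0 then a else b

open scoped ENNReal

section PathFun

variable {X : Type*}

theorem pathFun_succ_zero (n : ℕ) (a b : X) (η : Fin n → X) : pathFun (n + 1) a b η 0 = a := by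
  simp [pathFun]

theorem pathFun_cons_succ (n : ℕ) (a b : X) (η : Fin (n + 1) → X) (k : ℕ) :
    pathFun (n + 2) a b η (k + 1) = pathFun (n + 1) (η 0) b (fun j : Fin n => η j.succ) k := by
  rcases Nat.eq_zero_or_pos k with rfl | hk
  · simp [pathFun]
  · by_cases h : k < n + 1
    · have h' : k - 1 + 1 = k := Nat.sub_add_cancel hk
      simp [pathFun, h, hk.ne', Nat.one_le_iff_ne_zero, h']
    · simp [pathFun, h, hk.ne']

theorem pathFun_comp_rev (n : ℕ) (a b : X) (η : Fin n → X) {k : ℕ} (hk : k ≤ n + 1) :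
    pathFun (n + 1) b a (fun i : Fin n => η i.rev) k = pathFun (n + 1) a b η (n + 1 - k) := by
  rcases Nat.eq_zero_or_pos k with rfl | hk0
  · simp [pathFun]
  · rcases hk.eq_or_lt with rfl | hk1
    · simp [pathFun]
    · have h1 : 1 ≤ n + 1 - k ∧ n + 1 - k < n + 1 := by omega
      have h2 : 1 ≤ k ∧ k < n + 1 := ⟨hk0, hk1⟩
      simp only [pathFun, dif_pos h1, dif_pos h2]
      congr 1
      ext
      simp only [Fin.val_rev]
      omega

theorem measurable_pathFun [MeasurableSpace X] (n k : ℕ) :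
    Measurable fun p : X × X × (Fin n → X) => pathFun (n + 1) p.1 p.2.1 p.2.2 k := by
  unfold pathFun
  split_ifs
  · fun_prop
  · fun_prop
  · fun_prop

end PathFun

section PathWeight

variable {X : Type*} [MeasureSpace X] [SigmaFinite (volume : Measure X)]

/-- The total weight of the paths with `n` interior points from `a` to `b`, where the `k`-th step
has density `f k`. -/
noncomputable def pathWeight (f : ℕ → X → X → ℝ≥0∞) (n : ℕ) (a b : X) : ℝ≥0∞ :=
  ∫⁻ η : Fin n → X, ∏ k ∈ Finset.range (n + 1),
    f k (pathFun (n + 1) a b η k) (pathFun (n + 1) a b η (k + 1))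

theorem measurable_pathWeight {f : ℕ → X → X → ℝ≥0∞}
    (hf : ∀ k, Measurable (Function.uncurry (f k))) (n : ℕ) :
    Measurable (Function.uncurry (pathWeight f n)) := by
  refine Measurable.lintegral_prod_right' (f := fun p : (X × X) × (Fin n → X) =>
    ∏ k ∈ Finset.range (n + 1),
      f k (pathFun (n + 1) p.1.1 p.1.2 p.2 k) (pathFun (n + 1) p.1.1 p.1.2 p.2 (k + 1))) ?_
  have h (k : ℕ) : Measurable fun p : (X × X) × (Fin n → X) =>
      pathFun (n + 1) p.1.1 p.1.2 p.2 k :=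
    (measurable_pathFun n k).comp
      (measurable_fst.fst.prodMk (measurable_fst.snd.prodMk measurable_snd))
  exact Finset.measurable_prod _ fun k _ => (hf k).comp ((h k).prodMk (h (k + 1)))

theorem pathWeight_succ_le (f : ℕ → X → X → ℝ≥0∞) (hfin : ∀ k x y, f k x y ≠ ∞)
    (n : ℕ) (a b : X) :
    pathWeight f (n + 1) a b ≤ ∫⁻ x, f 0 a x * pathWeight (fun k => f (k + 1)) n x b := by
  have h := (volume_preserving_piFinSuccAbove (fun _ : Fin (n + 1) => X) 0).lintegral_map_equiv
    (fun p : X × (Fin n → X) => f 0 a p.1 * ∏ k ∈ Finset.range (n + 1),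
      f (k + 1) (pathFun (n + 1) p.1 b p.2 k) (pathFun (n + 1) p.1 b p.2 (k + 1)))
  calc pathWeight f (n + 1) a b
      = ∫⁻ p : X × (Fin n → X), f 0 a p.1 * ∏ k ∈ Finset.range (n + 1),
          f (k + 1) (pathFun (n + 1) p.1 b p.2 k) (pathFun (n + 1) p.1 b p.2 (k + 1)) := by
        rw [h]
        refine lintegral_congr fun η => ?_
        rw [Finset.prod_range_succ', mul_comm, pathFun_succ_zero]
        simp only [pathFun_cons_succ, pathFun_succ_zero]
        rfl
    _ ≤ _ := by
        refine (lintegral_prod_le _).trans_eq (lintegral_congr fun x => ?_)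
        exact lintegral_const_mul' _ _ (hfin 0 a x)

theorem lintegral_pathWeight_le_one (n : ℕ) {f : ℕ → X → X → ℝ≥0∞}
    (hf : ∀ k, Measurable (Function.uncurry (f k))) (hfin : ∀ k x y, f k x y ≠ ∞)
    (h1 : ∀ k x, ∫⁻ y, f k x y = 1) (a : X) :
    ∫⁻ b, pathWeight f n a b ≤ 1 := by
  induction n generalizing f a with
  | zero =>
    refine le_of_eq ?_
    rw [← h1 0 a]
    refine lintegral_congr fun b => ?_
    simp [pathWeight, pathFun, volume_pi]
  | succ n ih =>
    calc ∫⁻ b, pathWeight f (n + 1) a b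
        ≤ ∫⁻ b, ∫⁻ x, f 0 a x * pathWeight (fun k => f (k + 1)) n x b :=
          lintegral_mono fun b => pathWeight_succ_le f hfin n a b
      _ = ∫⁻ x, f 0 a x * ∫⁻ b, pathWeight (fun k => f (k + 1)) n x b := by
          rw [lintegral_lintegral_swap]
          · exact lintegral_congr fun x => lintegral_const_mul' _ _ (hfin 0 a x)
          · refine Measurable.aemeasurable ?_
            exact ((hf 0).comp (measurable_const.prodMk measurable_snd)).mul
              ((measurable_pathWeight (fun k => hf (k + 1)) n).comp measurable_swap)
      _ ≤ ∫⁻ x, f 0 a x * 1 := by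
          gcongr with x
          exact ih (fun k => hf (k + 1)) (fun k => hfin (k + 1)) (fun k => h1 (k + 1)) x
      _ = 1 := by simpa using h1 0 a

end PathWeight

theorem lintegral_ofReal_eq_one {α : Type*} [MeasurableSpace α] {μ : Measure α} {f : α → ℝ}
    (hf : ∀ x, 0 ≤ f x) (h : ∫ x, f x ∂μ = 1) : ∫⁻ x, ENNReal.ofReal (f x) ∂μ = 1 := by
  rw [← ofReal_integral_eq_lintegral_ofReal (integrable_of_integral_eq_one h)
    (Filter.Eventually.of_forall hf), h, ENNReal.ofReal_one]

theorem integral_comp_rev {X E : Type*} [MeasureSpace X] [SigmaFinite (volume : Measure X)]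
    [NormedAddCommGroup E] [NormedSpace ℝ E] {n : ℕ} (g : (Fin n → X) → E) :
    ∫ η : Fin n → X, g (fun i => η i.rev) = ∫ η, g η :=
  (volume_preserving_arrowCongr' (Fin.revPerm (n := n)) (MeasurableEquiv.refl X)
    (MeasurePreserving.id _)).integral_comp' g

theorem map_swap_withDensity_prod_self {α : Type*} [MeasurableSpace α] {μ : Measure α} [SFinite μ]
    {F : α × α → ℝ≥0∞} (hF : ∀ p, F p.swap = F p) :
    ((μ.prod μ).withDensity F).map Prod.swap = (μ.prod μ).withDensity F := by
  ext s hs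
  rw [Measure.map_apply measurable_swap hs, withDensity_apply _ (measurable_swap hs),
    withDensity_apply _ hs]
  have h := (Measure.measurePreserving_swap (μ := μ) (ν := μ)).setLIntegral_comp_preimage_emb
    MeasurableEquiv.prodComm.measurableEmbedding F s
  simpa only [hF] using h

theorem map_swap_map_diag {α : Type*} [MeasurableSpace α] (μ : Measure α) :
    (μ.map fun u => (u, u)).map Prod.swap = μ.map fun u => (u, u) := by
  rw [Measure.map_map measurable_swap (by fun_prop)]
  rfl

/-- Reversibility of the symmetric path algorithm: with `𝒬_s` the accepted-move
joint density, one has `∫ 𝒬_s(u, ·) ≤ exp(−βV(u))`, and the joint law `π` of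
`(X_n, X_{n+1})` (off-diagonal density `𝒵⁻¹ 𝒬_s` plus the diagonal rejection
part) is invariant under the swap `(u, v) ↦ (v, u)`, i.e. the chain is
reversible with respect to `ν = 𝒵⁻¹ exp(−βV) du`. -/
theorem stmt8 (ℓ d : ℕ) (hℓ : 0 < ℓ) (hld : ℓ < d)
    (β : ℝ) (hβ : 0 < β)
    (V : (Fin ℓ → ℝ) → (Fin (d - ℓ) → ℝ) → ℝ)
    (hV : Measurable (Function.uncurry V))
    (Zc : ℝ)
    (hZc : Zc = ∫ x : (Fin ℓ → ℝ) × (Fin (d - ℓ) → ℝ), Real.exp (-β * V x.1 x.2))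
    (hZpos : 0 < Zc)
    (hZfin : Integrable (fun x : (Fin ℓ → ℝ) × (Fin (d - ℓ) → ℝ) =>
      Real.exp (-β * V x.1 x.2)))
    (Q : (Fin ℓ → ℝ) → (Fin ℓ → ℝ) → ℝ)
    (hQmeas : Measurable (Function.uncurry Q))
    (hQnonneg : ∀ z z', 0 ≤ Q z z')
    (hQnorm : ∀ z, ∫ z', Q z z' = 1)
    (P : (Fin ℓ → ℝ) → (Fin (d - ℓ) → ℝ) → (Fin (d - ℓ) → ℝ) → ℝ)
    (hPmeas : Measurable (fun q : (Fin ℓ → ℝ) × (Fin (d - ℓ) → ℝ) × (Fin (d - ℓ) → ℝ) =>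
      P q.1 q.2.1 q.2.2))
    (hPnonneg : ∀ z x y, 0 ≤ P z x y)
    (hPnorm : ∀ z x, (∫ y, P z x y) = 1)
    (K : ℕ) (hK : 1 ≤ K)
    (zbar : ℕ → (Fin ℓ → ℝ) → (Fin ℓ → ℝ) → (Fin ℓ → ℝ))
    (hzbarmeas : ∀ k, Measurable (Function.uncurry (zbar k)))
    (hzbar0 : ∀ a b, zbar 0 a b = a)
    (hzbarK : ∀ a b, zbar K a b = b)
    (Qs : ((Fin ℓ → ℝ) × (Fin (d - ℓ) → ℝ)) →
      ((Fin ℓ → ℝ) × (Fin (d - ℓ) → ℝ)) → ℝ)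
    (hQs : ∀ u v, Qs u v =
      ∫ η : Fin K → (Fin (d - ℓ) → ℝ),
        min
          (Real.exp (-β * V u.1 u.2) * Q u.1 v.1 *
            ∏ k ∈ Finset.range (K + 1),
              P (zbar k u.1 v.1) (pathFun (K + 1) u.2 v.2 η k)
                (pathFun (K + 1) u.2 v.2 η (k + 1)))
          (Real.exp (-β * V v.1 v.2) * Q v.1 u.1 *
            ∏ k ∈ Finset.range (K + 1),
              P (zbar k v.1 u.1) (pathFun (K + 1) u.2 v.2 η (K + 1 - k))
                (pathFun (K + 1) u.2 v.2 η (K - k)))) :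
    (∀ u, (∫ w, Qs u w) ≤ Real.exp (-β * V u.1 u.2)) ∧
    (Measure.map Prod.swap
        ((volume.prod volume).withDensity
            (fun q => ENNReal.ofReal (Zc⁻¹ * Qs q.1 q.2)) +
          Measure.map (fun u => (u, u))
            (volume.withDensity fun u =>
              ENNReal.ofReal (Zc⁻¹ * Real.exp (-β * V u.1 u.2)) -
                ENNReal.ofReal (Zc⁻¹ * ∫ w, Qs u w))) =
      (volume.prod volume).withDensity
          (fun q => ENNReal.ofReal (Zc⁻¹ * Qs q.1 q.2)) +
        Measure.map (fun u => (u, u))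
          (volume.withDensity fun u =>
            ENNReal.ofReal (Zc⁻¹ * Real.exp (-β * V u.1 u.2)) -
              ENNReal.ofReal (Zc⁻¹ * ∫ w, Qs u w))) := by
  have hsymm : ∀ u v, Qs u v = Qs v u := by
    intro u v
    rw [hQs u v, hQs v u, ← integral_comp_rev]
    congr 1 with η
    rw [min_comm]
    congr 2
    · refine Finset.prod_congr rfl fun k hk => ?_
      have hk' := Finset.mem_range.1 hk
      rw [pathFun_comp_rev K v.2 u.2 η (by omega : K + 1 - k ≤ K + 1),
        pathFun_comp_rev K v.2 u.2 η (by omega : K - k ≤ K + 1)]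
      congr 2 <;> omega
    · refine Finset.prod_congr rfl fun k hk => ?_
      have hk' := Finset.mem_range.1 hk
      rw [pathFun_comp_rev K v.2 u.2 η (by omega : k ≤ K + 1),
        pathFun_comp_rev K v.2 u.2 η (by omega : k + 1 ≤ K + 1)]
      congr 2
      omega
  refine ⟨fun u => ?_, ?_⟩
  · let f (z : Fin ℓ → ℝ) (k : ℕ) (x y : Fin (d - ℓ) → ℝ) : ℝ≥0∞ :=
      ENNReal.ofReal (P (zbar k u.1 z) x y)
    have hf (z : Fin ℓ → ℝ) (k : ℕ) : Measurable (Function.uncurry (f z k)) :=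
      (hPmeas.comp (measurable_const.prodMk measurable_id)).ennreal_ofReal
    have hle (v : (Fin ℓ → ℝ) × (Fin (d - ℓ) → ℝ)) :
        ‖Qs u v‖ₑ ≤ ENNReal.ofReal (Real.exp (-β * V u.1 u.2)) * ENNReal.ofReal (Q u.1 v.1) *
          pathWeight (f v.1) K u.2 v.2 := by
      rw [hQs, pathWeight, ← lintegral_const_mul' _ _
        (ENNReal.mul_ne_top ENNReal.ofReal_ne_top ENNReal.ofReal_ne_top)]
      refine (enorm_integral_le_lintegral_enorm _).trans (lintegral_mono fun η => ?_)
      rw [← ENNReal.ofReal_prod_of_nonneg fun _ _ => hPnonneg _ _ _,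
        ← ENNReal.ofReal_mul (Real.exp_nonneg _),
        ← ENNReal.ofReal_mul (mul_nonneg (Real.exp_nonneg _) (hQnonneg _ _)),
        Real.enorm_of_nonneg]
      · exact ENNReal.ofReal_le_ofReal (min_le_left _ _)
      · refine le_min ?_ ?_ <;>
        exact mul_nonneg (mul_nonneg (Real.exp_nonneg _) (hQnonneg _ _))
          (Finset.prod_nonneg fun _ _ => hPnonneg _ _ _)
    have hbound : ‖∫ w, Qs u w‖ₑ ≤ ENNReal.ofReal (Real.exp (-β * V u.1 u.2)) :=
      calc ‖∫ w, Qs u w‖ₑ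
          ≤ ∫⁻ w, ‖Qs u w‖ₑ := enorm_integral_le_lintegral_enorm _
        _ ≤ ∫⁻ z, ∫⁻ x, ‖Qs u (z, x)‖ₑ := lintegral_prod_le _
        _ ≤ ∫⁻ z, ENNReal.ofReal (Real.exp (-β * V u.1 u.2)) * ENNReal.ofReal (Q u.1 z) := by
            refine lintegral_mono fun z => (lintegral_mono fun x => hle (z, x)).trans ?_
            dsimp only
            rw [lintegral_const_mul' _ _
              (ENNReal.mul_ne_top ENNReal.ofReal_ne_top ENNReal.ofReal_ne_top)]
            exact mul_le_of_le_one_right' <| lintegral_pathWeight_le_one K (hf z)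
              (fun _ _ _ => ENNReal.ofReal_ne_top)
              (fun _ _ => lintegral_ofReal_eq_one (hPnonneg _ _) (hPnorm _ _)) u.2
        _ = _ := by
            rw [lintegral_const_mul' _ _ ENNReal.ofReal_ne_top,
              lintegral_ofReal_eq_one (hQnonneg _) (hQnorm _), mul_one]
    rw [Real.enorm_eq_ofReal_abs, ENNReal.ofReal_le_ofReal_iff (Real.exp_nonneg _)] at hbound
    exact (le_abs_self _).trans hbound
  · rw [Measure.map_add _ _ measurable_swap, map_swap_map_diag,
      map_swap_withDensity_prod_self fun p => by rw [Prod.fst_swap, Prod.snd_swap, hsymm]]
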